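/- arXiv:0908.3409 — 3 statements merged into one kernel-verified Lean document; each statement's English description precedes it below -/
import Mathlib

section
/- For every α ∈ (0,1) there exists k(α) < ∞ such that for every λ > k(α) there exist ℕ-valued random variables X and Y on a common probability space such that X, Y and X+Y have Poisson distributions with respective means αλ, (1−α)λ and λ, and moreover P(X+Y = 1 and Y ≥ 1) = 0 and P(X+Y = 2 and X ≥ 1) = 0 (equivalently, P(Y = 0 | X+Y = 1) = 1 = P(X = 0 | X+Y = 2)). -/
open MeasureTheory ProbabilityTheory

noncomputable section

/-- Poisson probability mass function with mean `m`. -/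
def poissonProb (m : ℝ) (k : ℕ) : ENNReal :=
  ENNReal.ofReal (Real.exp (-m) * m ^ k / (Nat.factorial k))

/-- The Poisson weight with mean `m`, as a real number. -/
def poissonWeight (m : ℝ) (k : ℕ) : ℝ :=
  Real.exp (-m) * m ^ k / (Nat.factorial k)

lemma poissonWeight_nonneg {m : ℝ} (hm : 0 ≤ m) (k : ℕ) : 0 ≤ poissonWeight m k := by
  unfold poissonWeight; positivity

lemma hasSum_poissonWeight (m : ℝ) : HasSum (poissonWeight m) 1 := by
  have h := (NormedSpace.expSeries_div_hasSum_exp m).mul_left (Real.exp (-m))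
  rw [← Real.exp_eq_exp_ℝ, ← Real.exp_add, neg_add_cancel, Real.exp_zero] at h
  exact h.congr_fun fun k => by simp [poissonWeight, mul_div_assoc]

lemma sum_antidiagonal_poissonWeight_mul (a b : ℝ) (n : ℕ) :
    ∑ x ∈ Finset.HasAntidiagonal.antidiagonal n, poissonWeight a x.1 * poissonWeight b x.2 =
      poissonWeight (a + b) n := by
  rw [poissonWeight, (Commute.all a b).add_pow', neg_add, Real.exp_add, Finset.mul_sum,
    Finset.sum_div]
  refine Finset.sum_congr rfl fun x hx => ?_
  obtain rfl := Finset.HasAntidiagonal.mem_antidiagonal.mp hx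
  have h : ((x.1 + x.2).choose x.1 : ℝ) * x.1.factorial * x.2.factorial =
      (x.1 + x.2).factorial := by
    rw [Nat.choose_symm_add]
    exact_mod_cast Nat.add_choose_mul_factorial_mul_factorial x.1 x.2
  rw [← h]
  have h₁ : (x.1.factorial : ℝ) ≠ 0 := by positivity
  have h₂ : (x.2.factorial : ℝ) ≠ 0 := by positivity
  have h₃ : ((x.1 + x.2).choose x.1 : ℝ) ≠ 0 := by
    exact_mod_cast (Nat.choose_pos (Nat.le_add_right _ _)).ne'
  simp only [poissonWeight, nsmul_eq_mul]
  field_simp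

/-- The coefficients of `(x - 1) * (y - 1) * (x - y) * (c - u * x - v * y)`: a matrix whose
rows, columns and antidiagonals all sum to zero. -/
def perturbation (c u v : ℝ) : ℕ → ℕ → ℝ
  | 0, 1 => -c
  | 1, 0 => c
  | 2, 0 => -c - u
  | 0, 2 => c + v
  | 1, 1 => u - v
  | 2, 1 => c + v
  | 1, 2 => -c - u
  | 3, 0 => u
  | 0, 3 => -v
  | 3, 1 => -u
  | 2, 2 => u - v
  | 1, 3 => v
  | _, _ => 0

lemma perturbation_eq_zero_of_five_le (c u v : ℝ) {i j : ℕ} (h : 5 ≤ i + j) :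
    perturbation c u v i j = 0 := by
  unfold perturbation
  split <;> first | rfl | omega

lemma perturbation_eq_zero_of_four_le_left (c u v : ℝ) {i : ℕ} (j : ℕ) (h : 4 ≤ i) :
    perturbation c u v i j = 0 := by
  unfold perturbation
  split <;> first | rfl | omega

lemma perturbation_eq_zero_of_four_le_right (c u v : ℝ) (i : ℕ) {j : ℕ} (h : 4 ≤ j) :
    perturbation c u v i j = 0 := by
  unfold perturbation
  split <;> first | rfl | omega

lemma hasSum_perturbation_row (c u v : ℝ) (i : ℕ) : HasSum (perturbation c u v i) 0 := by
  have h : ∑ j ∈ Finset.range 4, perturbation c u v i j = 0 := by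
    rcases lt_or_ge i 4 with hi | hi
    · interval_cases i <;> simp [Finset.sum_range_succ, perturbation] <;> ring
    · exact Finset.sum_eq_zero fun j _ => perturbation_eq_zero_of_four_le_left c u v j hi
  rw [← h]
  exact hasSum_sum_of_ne_finset_zero fun j hj =>
    perturbation_eq_zero_of_four_le_right c u v i (by simpa using hj)

lemma hasSum_perturbation_column (c u v : ℝ) (j : ℕ) :
    HasSum (fun i => perturbation c u v i j) 0 := by
  have h : ∑ i ∈ Finset.range 4, perturbation c u v i j = 0 := by
    rcases lt_or_ge j 4 with hj | hj
    · interval_cases j <;> simp [Finset.sum_range_succ, perturbation] <;> ring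
    · exact Finset.sum_eq_zero fun i _ => perturbation_eq_zero_of_four_le_right c u v i hj
  rw [← h]
  exact hasSum_sum_of_ne_finset_zero fun i hi =>
    perturbation_eq_zero_of_four_le_left c u v j (by simpa using hi)

lemma sum_antidiagonal_perturbation (c u v : ℝ) (n : ℕ) :
    ∑ x ∈ Finset.HasAntidiagonal.antidiagonal n, perturbation c u v x.1 x.2 = 0 := by
  rcases lt_or_ge n 5 with hn | hn
  · rw [Finset.Nat.sum_antidiagonal_eq_sum_range_succ_mk]
    interval_cases n <;> simp [Finset.sum_range_succ, perturbation] <;> ring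
  · exact Finset.sum_eq_zero fun x hx => perturbation_eq_zero_of_five_le c u v
      (by rw [Finset.HasAntidiagonal.mem_antidiagonal.mp hx]; exact hn)

/-- The joint weights of the coupling: those of independent Poisson variables of means `a` and
`b`, perturbed so as to vanish at `(0, 1)`, `(1, 1)` and `(2, 0)`. -/
def couplingWeight (a b : ℝ) (i j : ℕ) : ℝ :=
  poissonWeight a i * poissonWeight b j +
    perturbation (Real.exp (-a) * Real.exp (-b) * b)
      (Real.exp (-a) * Real.exp (-b) * (a ^ 2 / 2 - b))
      (Real.exp (-a) * Real.exp (-b) * (a ^ 2 / 2 + a * b - b)) i j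

lemma couplingWeight_nonneg {a b : ℝ} (ha : 0 < a) (hb : 0 < b) (hab : 4 ≤ a * b)
    (h₁ : 2 * b ≤ a ^ 2) (h₂ : a ≤ b ^ 2) (h₃ : a ^ 2 / 2 + a * b ≤ b ^ 3 / 6) (i j : ℕ) :
    0 ≤ couplingWeight a b i j := by
  have hE : 0 < Real.exp (-a) * Real.exp (-b) := by positivity
  have hu : 0 ≤ a ^ 2 / 2 - b := by linarith
  have hv : 0 ≤ a ^ 2 / 2 + a * b - b := by linarith
  have hp := mul_nonneg (poissonWeight_nonneg ha.le i) (poissonWeight_nonneg hb.le j)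
  have hq : poissonWeight a i * poissonWeight b j = Real.exp (-a) * Real.exp (-b) *
      (a ^ i / i.factorial * (b ^ j / j.factorial)) := by
    simp only [poissonWeight]; ring
  have h₄ : 0 ≤ a * (b ^ 2 - a) := mul_nonneg ha.le (by linarith)
  have h₅ : 0 ≤ a ^ 2 * (a * b - 4) := mul_nonneg (by positivity) (by linarith)
  have h₆ : 0 ≤ a * b * (a * b - 4) := mul_nonneg (by positivity) (by linarith)
  have hf : ((3 : ℕ).factorial : ℝ) = 6 := by norm_num [Nat.factorial]
  unfold couplingWeight
  rw [hq] at hp ⊢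
  generalize Real.exp (-a) * Real.exp (-b) = E at *
  unfold perturbation
  split
  case h_13 => simpa using hp
  all_goals
    clear hq hp
    simp only [hf, Nat.factorial_zero, Nat.factorial_one, Nat.factorial_two, pow_zero, pow_one,
      Nat.cast_one, Nat.cast_ofNat, div_one, one_mul, mul_one, ← mul_add, ← mul_sub, ← mul_neg]
    refine mul_nonneg hE.le ?_
  all_goals nlinarith

lemma hasSum_couplingWeight_row (a b : ℝ) (i : ℕ) :
    HasSum (couplingWeight a b i) (poissonWeight a i) := by
  rw [← add_zero (poissonWeight a i), ← mul_one (poissonWeight a i)]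
  exact ((hasSum_poissonWeight b).mul_left (poissonWeight a i)).add
    (hasSum_perturbation_row _ _ _ i)

lemma hasSum_couplingWeight_column (a b : ℝ) (j : ℕ) :
    HasSum (fun i => couplingWeight a b i j) (poissonWeight b j) := by
  rw [← add_zero (poissonWeight b j), ← one_mul (poissonWeight b j)]
  exact ((hasSum_poissonWeight a).mul_right (poissonWeight b j)).add
    (hasSum_perturbation_column _ _ _ j)

lemma sum_antidiagonal_couplingWeight (a b : ℝ) (n : ℕ) :
    ∑ x ∈ Finset.HasAntidiagonal.antidiagonal n, couplingWeight a b x.1 x.2 =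
      poissonWeight (a + b) n := by
  simp only [couplingWeight, Finset.sum_add_distrib, sum_antidiagonal_perturbation, add_zero,
    sum_antidiagonal_poissonWeight_mul]

lemma couplingWeight_zero_one (a b : ℝ) : couplingWeight a b 0 1 = 0 := by
  simp [couplingWeight, perturbation, poissonWeight]; ring

lemma couplingWeight_one_one (a b : ℝ) : couplingWeight a b 1 1 = 0 := by
  simp [couplingWeight, perturbation, poissonWeight]; ring

lemma couplingWeight_two_zero (a b : ℝ) : couplingWeight a b 2 0 = 0 := by
  simp [couplingWeight, perturbation, poissonWeight]; ring

/-- The measure on `ℕ × ℕ` with weight `q i j` at `(i, j)`. -/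
def weightMeasure (q : ℕ → ℕ → ℝ) : Measure (ℕ × ℕ) :=
  Measure.sum fun x => ENNReal.ofReal (q x.1 x.2) • Measure.dirac x

lemma weightMeasure_apply (q : ℕ → ℕ → ℝ) (s : Set (ℕ × ℕ)) :
    weightMeasure q s = ∑' x, s.indicator (fun x => ENNReal.ofReal (q x.1 x.2)) x := by
  classical
  rw [weightMeasure, Measure.sum_apply _ (.of_discrete)]
  refine tsum_congr fun x => ?_
  by_cases hx : x ∈ s <;> simp [hx]

lemma weightMeasure_fst_eq {q : ℕ → ℕ → ℝ} (hq : ∀ i j, 0 ≤ q i j) {i : ℕ} {r : ℝ}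
    (h : HasSum (q i) r) : weightMeasure q {x | x.1 = i} = ENNReal.ofReal r := by
  rw [weightMeasure_apply, ENNReal.tsum_prod', tsum_eq_single i, ← h.tsum_eq,
    ENNReal.ofReal_tsum_of_nonneg (hq i) h.summable]
  · simp
  · intro k hk
    simp [hk]

lemma weightMeasure_snd_eq {q : ℕ → ℕ → ℝ} (hq : ∀ i j, 0 ≤ q i j) {j : ℕ} {r : ℝ}
    (h : HasSum (fun i => q i j) r) : weightMeasure q {x | x.2 = j} = ENNReal.ofReal r := by
  rw [weightMeasure_apply, ENNReal.tsum_prod', ENNReal.tsum_comm, tsum_eq_single j, ← h.tsum_eq,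
    ENNReal.ofReal_tsum_of_nonneg (fun i => hq i j) h.summable]
  · simp
  · intro k hk
    simp [hk]

lemma weightMeasure_add_eq {q : ℕ → ℕ → ℝ} (hq : ∀ i j, 0 ≤ q i j) (n : ℕ) :
    weightMeasure q {x | x.1 + x.2 = n} =
      ENNReal.ofReal (∑ x ∈ Finset.HasAntidiagonal.antidiagonal n, q x.1 x.2) := by
  rw [weightMeasure_apply, ENNReal.ofReal_sum_of_nonneg fun x _ => hq x.1 x.2,
    tsum_eq_sum (s := Finset.HasAntidiagonal.antidiagonal n)]
  · refine Finset.sum_congr rfl fun x hx => ?_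
    rw [Set.indicator_of_mem]
    exact Finset.HasAntidiagonal.mem_antidiagonal.mp hx
  · intro x hx
    rw [Set.indicator_of_notMem]
    simpa using hx

lemma weightMeasure_eq_zero {q : ℕ → ℕ → ℝ} {s : Set (ℕ × ℕ)} (h : ∀ x ∈ s, q x.1 x.2 = 0) :
    weightMeasure q s = 0 := by
  rw [weightMeasure_apply, ENNReal.tsum_eq_zero]
  intro x
  by_cases hx : x ∈ s <;> simp [hx, h]

lemma isProbabilityMeasure_weightMeasure {q : ℕ → ℕ → ℝ} (hq : ∀ i j, 0 ≤ q i j) {r : ℕ → ℝ}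
    (h : ∀ i, HasSum (q i) (r i)) (hr : HasSum r 1) :
    IsProbabilityMeasure (weightMeasure q) := by
  have hsum : ∀ i, ∑' j, ENNReal.ofReal (q i j) = ENNReal.ofReal (r i) := fun i => by
    rw [← (h i).tsum_eq, ENNReal.ofReal_tsum_of_nonneg (hq i) (h i).summable]
  constructor
  rw [weightMeasure_apply, ENNReal.tsum_prod']
  simp only [Set.indicator_univ, hsum]
  rw [← ENNReal.ofReal_tsum_of_nonneg (fun i => (h i).nonneg (hq i)) hr.summable, hr.tsum_eq,
    ENNReal.ofReal_one]

/-- **A coupling of Poisson random variables** (Holroyd--Lyons--Soo, Lemma 14).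
For every `α ∈ (0,1)` there is `k(α) < ∞` such that for every `λ > k(α)` there exist random
variables `X`, `Y` with `X`, `Y`, `X + Y` Poisson of means `αλ`, `(1-α)λ`, `λ`, such that
`Y = 0` a.s. on `{X + Y = 1}` and `X = 0` a.s. on `{X + Y = 2}`. -/
theorem poisson_coupling (α : ℝ) (h0 : 0 < α) (h1 : α < 1) :
    ∃ k : ℝ, ∀ lam : ℝ, k < lam →
      ∃ (Ω : Type) (_ : MeasurableSpace Ω) (P : Measure Ω) (_ : IsProbabilityMeasure P)
        (X Y : Ω → ℕ),
        Measurable X ∧ Measurable Y ∧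
        (∀ i : ℕ, P {ω | X ω = i} = poissonProb (α * lam) i) ∧
        (∀ i : ℕ, P {ω | Y ω = i} = poissonProb ((1 - α) * lam) i) ∧
        (∀ i : ℕ, P {ω | X ω + Y ω = i} = poissonProb lam i) ∧
        P {ω | X ω + Y ω = 1 ∧ 1 ≤ Y ω} = 0 ∧
        P {ω | X ω + Y ω = 2 ∧ 1 ≤ X ω} = 0 := by
  have hβ : 0 < 1 - α := by linarith
  refine ⟨9 / (α ^ 2 * (1 - α) ^ 3), fun lam hlam => ?_⟩
  have hlam₀ : 0 < lam := lt_trans (by positivity) hlam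
  rw [div_lt_iff₀ (by positivity)] at hlam
  obtain ⟨β, rfl⟩ : ∃ β, α = 1 - β := ⟨1 - α, by ring⟩
  simp only [sub_sub_cancel] at *
  set a := (1 - β) * lam with ha_def
  set b := β * lam with hb_def
  have ha : 0 < a := by positivity
  have hb : 0 < b := by positivity
  have hadd : a + b = lam := by rw [ha_def, hb_def]; ring
  have hβ₁ : β ≤ 1 := by linarith
  have hα₁ : 1 - β ≤ 1 := by linarith
  have hA : 9 ≤ (1 - β) ^ 2 * lam := by
    nlinarith [mul_nonneg (by positivity : 0 ≤ lam * (1 - β) ^ 2)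
      (sub_nonneg.mpr (pow_le_one₀ hβ.le hβ₁ : β ^ 3 ≤ 1))]
  have hB : 9 ≤ β ^ 3 * lam := by
    nlinarith [mul_nonneg (by positivity : 0 ≤ lam * β ^ 3)
      (sub_nonneg.mpr (pow_le_one₀ h0.le hα₁ : (1 - β) ^ 2 ≤ 1))]
  have hB₂ : 9 ≤ β ^ 2 * lam := by
    nlinarith [mul_nonneg (by positivity : 0 ≤ lam * β ^ 2) (sub_nonneg.mpr hβ₁)]
  have ha₉ : 9 ≤ a := by
    nlinarith [mul_nonneg (by positivity : 0 ≤ lam * (1 - β)) (sub_nonneg.mpr hα₁)]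
  have hb₉ : 9 ≤ b := by
    nlinarith [mul_nonneg (by positivity : 0 ≤ lam * β) (sub_nonneg.mpr hβ₁)]
  have hab : 4 ≤ a * b := by nlinarith
  have h₁ : 2 * b ≤ a ^ 2 := by
    have : a ^ 2 = (1 - β) ^ 2 * lam * lam := by rw [ha_def]; ring
    nlinarith
  have h₂ : a ≤ b ^ 2 := by
    have : b ^ 2 = β ^ 2 * lam * lam := by rw [hb_def]; ring
    nlinarith
  have h₃ : a ^ 2 / 2 + a * b ≤ b ^ 3 / 6 := by
    have hb₃ : b ^ 3 = β ^ 3 * lam * lam ^ 2 := by rw [hb_def]; ring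
    have hle : 9 * lam ^ 2 ≤ b ^ 3 := by
      rw [hb₃]; exact mul_le_mul_of_nonneg_right hB (by positivity)
    rw [← hadd] at hle
    nlinarith [mul_pos ha hb, mul_pos hb hb, mul_pos ha ha]
  have hq := couplingWeight_nonneg ha hb hab h₁ h₂ h₃
  refine ⟨ℕ × ℕ, inferInstance, weightMeasure (couplingWeight a b),
    isProbabilityMeasure_weightMeasure hq (hasSum_couplingWeight_row a b)
      (hasSum_poissonWeight a), Prod.fst, Prod.snd, measurable_fst, measurable_snd,
    fun i => weightMeasure_fst_eq hq (hasSum_couplingWeight_row a b i),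
    fun j => weightMeasure_snd_eq hq (hasSum_couplingWeight_column a b j), fun n => ?_,
    weightMeasure_eq_zero ?_, weightMeasure_eq_zero ?_⟩
  · rw [weightMeasure_add_eq hq, sum_antidiagonal_couplingWeight, hadd]
    rfl
  · rintro ⟨i, j⟩ ⟨hsum, hj⟩
    obtain ⟨rfl, rfl⟩ : i = 0 ∧ j = 1 := by simp only at hsum hj; omega
    exact couplingWeight_zero_one a b
  · rintro ⟨i, j⟩ ⟨hsum, hi⟩
    obtain ⟨rfl, rfl⟩ | ⟨rfl, rfl⟩ : (i = 1 ∧ j = 1) ∨ (i = 2 ∧ j = 0) := by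
      simp only at hsum hi; omega
    · exact couplingWeight_one_one a b
    · exact couplingWeight_two_zero a b
end
end

section
/- Let (Ω, F, P) be a probability space and let F₁, F₂ ⊆ F be sub-σ-fields. Let U₁ be an F₁-measurable random variable and U₂ an F₂-measurable random variable, each uniformly distributed on [0,1], such that U₁ is independent of F₂ and U₂ is independent of F₁. Then U := U₁ ⊕ U₂ is uniformly distributed on [0,1], is independent of F₁, and is independent of F₂. -/
open MeasureTheory ProbabilityTheory

noncomputable section

/-- Addition modulo one: `x ⊕ y` is the unique `z ∈ [0,1)` with `x + y - z ∈ ℤ`. -/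
def addMod1 (x y : ℝ) : ℝ := Int.fract (x + y)

lemma addMod1_comm (x y : ℝ) : addMod1 x y = addMod1 y x := by
  rw [addMod1, addMod1, add_comm]

lemma measurable_addMod1 : Measurable fun p : ℝ × ℝ => addMod1 p.1 p.2 :=
  (measurable_fst.add measurable_snd).fract

/-- The uniform law on `[0,1]` is invariant under translation modulo one. -/
lemma map_addMod1_const (c : ℝ) :
    (volume.restrict (Set.Icc (0 : ℝ) 1)).map (fun x => addMod1 x c)
      = volume.restrict (Set.Icc (0 : ℝ) 1) := by
  have hm : Measurable fun x => addMod1 x c := (measurable_id.add_const c).fract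
  ext A hA
  rw [Measure.map_apply hm hA]
  have hB : MeasurableSet (Int.fract ⁻¹' A : Set ℝ) := measurable_fract hA
  have htrans : volume ((fun x => addMod1 x c) ⁻¹' A ∩ Set.Ioc 0 1)
      = volume ((Int.fract ⁻¹' A : Set ℝ) ∩ Set.Ioc c (c + 1)) := by
    rw [← measure_preimage_add_right volume c (Int.fract ⁻¹' A ∩ Set.Ioc c (c + 1))]
    congr 1
    ext x
    simp [addMod1, add_comm c]
  have hdom : volume ((Int.fract ⁻¹' A : Set ℝ) ∩ Set.Ioc c (c + 1))
      = volume ((Int.fract ⁻¹' A : Set ℝ) ∩ Set.Ioc 0 (0 + 1)) := by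
    refine (isAddFundamentalDomain_Ioc one_pos c).measure_set_eq
      (isAddFundamentalDomain_Ioc one_pos 0) hB ?_
    rintro ⟨g, hg⟩
    obtain ⟨n, rfl⟩ := AddSubgroup.mem_zmultiples_iff.1 hg
    ext x
    simp [AddSubgroup.vadd_def]
  have hfract : (Int.fract ⁻¹' A : Set ℝ) ∩ Set.Ico 0 1 = A ∩ Set.Ico 0 1 := by
    ext x
    simp only [Set.mem_inter_iff, Set.mem_preimage, and_congr_left_iff]
    intro hx
    rw [Int.fract_eq_self.2 hx]
  rw [← restrict_Ioc_eq_restrict_Icc, Measure.restrict_apply (hm hA), htrans, hdom, zero_add,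
    ← Measure.restrict_apply hB, ← restrict_Ico_eq_restrict_Ioc, Measure.restrict_apply hB, hfract,
    Measure.restrict_apply hA]

/-- If `V` is uniform and independent of `X`, then translating `V` modulo one by a function of `X`
gives a uniform variable independent of `X`, in product form. -/
lemma measure_addMod1_preimage_inter {Ω Ω' : Type*} [MeasurableSpace Ω] [MeasurableSpace Ω']
    (P : Measure Ω) [IsProbabilityMeasure P] {V : Ω → ℝ} {X : Ω → Ω'} {w : Ω' → ℝ}
    (hV : Measurable V) (hX : Measurable X) (hw : Measurable w)
    (hlaw : P.map V = volume.restrict (Set.Icc (0 : ℝ) 1)) (hi : IndepFun V X P)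
    {A : Set ℝ} (hA : MeasurableSet A) {E : Set Ω'} (hE : MeasurableSet E) :
    P ((fun ω => addMod1 (V ω) (w (X ω))) ⁻¹' A ∩ X ⁻¹' E)
      = volume.restrict (Set.Icc (0 : ℝ) 1) A * P (X ⁻¹' E) := by
  have := Measure.isProbabilityMeasure_map (μ := P) hX.aemeasurable
  have hprod := (indepFun_iff_map_prod_eq_prod_map_map hV.aemeasurable hX.aemeasurable).1 hi
  set S : Set (ℝ × Ω') := {p | addMod1 p.1 (w p.2) ∈ A} ∩ {p | p.2 ∈ E}
  have hS : MeasurableSet S :=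
    (measurable_addMod1.comp (measurable_fst.prodMk (hw.comp measurable_snd)) hA).inter
      (measurable_snd hE)
  have hslice : ∀ y, volume.restrict (Set.Icc (0 : ℝ) 1) ((fun x => (x, y)) ⁻¹' S)
      = E.indicator (fun _ => volume.restrict (Set.Icc (0 : ℝ) 1) A) y := by
    intro y
    by_cases hy : y ∈ E
    · have hmy : Measurable fun x => addMod1 x (w y) := (measurable_id.add_const (w y)).fract
      rw [Set.indicator_of_mem hy, ← map_addMod1_const (w y), Measure.map_apply hmy hA,
        map_addMod1_const]
      congr 1
      ext x
      simp [S, hy]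
    · have : (fun x : ℝ => (x, y)) ⁻¹' S = ∅ := by
        ext x
        simp [S, hy]
      rw [this, Set.indicator_of_notMem hy, measure_empty]
  calc P ((fun ω => addMod1 (V ω) (w (X ω))) ⁻¹' A ∩ X ⁻¹' E)
      = P.map (fun ω => (V ω, X ω)) S := by rw [Measure.map_apply (hV.prodMk hX) hS]; rfl
    _ = volume.restrict (Set.Icc (0 : ℝ) 1) A * P (X ⁻¹' E) := by
      rw [hprod, hlaw, Measure.prod_apply_symm hS]
      simp_rw [hslice]
      rw [lintegral_indicator_const hE, Measure.map_apply hX hE]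

/-- A uniform variable independent of `G`, translated modulo one by a `G`-measurable variable,
remains uniform and independent of `G`. -/
lemma map_addMod1_and_indep {Ω : Type*} (G : MeasurableSpace Ω) [mΩ : MeasurableSpace Ω]
    (P : Measure Ω) [IsProbabilityMeasure P] (hG : G ≤ mΩ) (V W : Ω → ℝ)
    (hV : Measurable V) (hW : Measurable[G] W)
    (hlaw : P.map V = volume.restrict (Set.Icc (0 : ℝ) 1))
    (hi : Indep (MeasurableSpace.comap V inferInstance) G P) :
    P.map (fun ω => addMod1 (V ω) (W ω)) = volume.restrict (Set.Icc (0 : ℝ) 1) ∧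
    Indep (MeasurableSpace.comap (fun ω => addMod1 (V ω) (W ω)) inferInstance) G P := by
  have hm : Measurable fun ω => addMod1 (V ω) (W ω) :=
    measurable_addMod1.comp (hV.prodMk (hW.mono hG le_rfl))
  have hid : Measurable[mΩ, G] (id : Ω → Ω) := measurable_id.mono hG le_rfl
  have hindep : @IndepFun Ω ℝ Ω mΩ _ G V id P := by
    refine (@IndepFun_iff_Indep Ω ℝ Ω mΩ _ G V id P).2 ?_
    rwa [@MeasurableSpace.comap_id Ω G]
  have key : ∀ A : Set ℝ, MeasurableSet A → ∀ E : Set Ω, MeasurableSet[G] E →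
      P ((fun ω => addMod1 (V ω) (W ω)) ⁻¹' A ∩ E)
        = volume.restrict (Set.Icc (0 : ℝ) 1) A * P E := fun A hA E hE =>
    @measure_addMod1_preimage_inter Ω Ω mΩ G P _ V id W hV hid hW hlaw hindep A hA E hE
  have hmap : P.map (fun ω => addMod1 (V ω) (W ω)) = volume.restrict (Set.Icc (0 : ℝ) 1) := by
    ext A hA
    rw [Measure.map_apply hm hA]
    simpa using key A hA Set.univ MeasurableSet.univ
  refine ⟨hmap, (Indep_iff _ _ _).2 ?_⟩
  rintro _ E ⟨A, hA, rfl⟩ hE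
  rw [key A hA E hE, ← hmap, Measure.map_apply hm hA]

/-- **Adding uniform random variables modulo 1** (Holroyd--Lyons--Soo, Lemma 9).
If `U₁` is `F₁`-measurable, `U₂` is `F₂`-measurable, both are uniform on `[0,1]`, `U₁` is
independent of `F₂` and `U₂` is independent of `F₁`, then `U := U₁ ⊕ U₂` is uniform on
`[0,1]` and independent of each of `F₁` and `F₂`. -/
theorem add_mod_one_uniform
    {Ω : Type} [mΩ : MeasurableSpace Ω] (P : Measure Ω) [IsProbabilityMeasure P]
    (F₁ F₂ : MeasurableSpace Ω) (hF₁ : F₁ ≤ mΩ) (hF₂ : F₂ ≤ mΩ)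
    (U₁ U₂ : Ω → ℝ)
    (hU₁m : @Measurable Ω ℝ F₁ _ U₁) (hU₂m : @Measurable Ω ℝ F₂ _ U₂)
    (hU₁law : @Measure.map Ω ℝ mΩ _ U₁ P = volume.restrict (Set.Icc (0:ℝ) 1))
    (hU₂law : @Measure.map Ω ℝ mΩ _ U₂ P = volume.restrict (Set.Icc (0:ℝ) 1))
    (hi₁ : Indep (MeasurableSpace.comap U₁ inferInstance) F₂ P)
    (hi₂ : Indep (MeasurableSpace.comap U₂ inferInstance) F₁ P) :
    @Measure.map Ω ℝ mΩ _ (fun ω => addMod1 (U₁ ω) (U₂ ω)) P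
        = volume.restrict (Set.Icc (0:ℝ) 1) ∧
    Indep (MeasurableSpace.comap (fun ω => addMod1 (U₁ ω) (U₂ ω)) inferInstance) F₁ P ∧
    Indep (MeasurableSpace.comap (fun ω => addMod1 (U₁ ω) (U₂ ω)) inferInstance) F₂ P := by
  obtain ⟨hlaw, hindep₂⟩ := map_addMod1_and_indep F₂ (mΩ := mΩ) P hF₂ U₁ U₂ (hU₁m.mono hF₁ le_rfl) hU₂m
    hU₁law hi₁
  have hindep₁ := (map_addMod1_and_indep F₁ (mΩ := mΩ) P hF₁ U₂ U₁ (hU₂m.mono hF₂ le_rfl) hU₁m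
    hU₂law hi₂).2
  simp only [addMod1_comm (U₂ _)] at hindep₁
  exact ⟨hlaw, hindep₁, hindep₂⟩
end
end

section
/- Let (S, 𝒮) be a measurable space in which the diagonal {(x,y) ∈ S × S : x = y} is measurable for the product σ-algebra. Let X and Y be independent S-valued random variables, and let A := {y ∈ S : P(Y = y) > 0}. Then P({X = Y} ∩ {Y ∈ A^c}) = 0. -/
open MeasureTheory ProbabilityTheory

noncomputable section

/-- **Independent random variables hitting atomless values** (Holroyd--Lyons--Soo, Lemma 6).
If `X` and `Y` are independent random variables with values in a measurable space whose
diagonal is measurable, and `A := {y | P(Y = y) > 0}`, then `P(X = Y, Y ∉ A) = 0`. -/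
theorem indep_eq_null_off_atoms
    {S : Type} [MeasurableSpace S]
    (hdiag : MeasurableSet {p : S × S | p.1 = p.2})
    {Ω : Type} [MeasurableSpace Ω] (P : Measure Ω) [IsProbabilityMeasure P]
    (X Y : Ω → S) (hX : Measurable X) (hY : Measurable Y)
    (hindep : IndepFun X Y P) :
    P ({ω | X ω = Y ω} ∩ {ω | Y ω ∈ ({y : S | 0 < P {ω' | Y ω' = y}})ᶜ}) = 0 := by
  set D : Set (S × S) := {p | p.1 = p.2}
  have hslice (y : S) : P {ω | Y ω = y} = P.map Y (Prod.mk y ⁻¹' D) := by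
    rw [Measure.map_apply hY (measurable_prodMk_left hdiag)]
    congr 1
    ext ω
    exact eq_comm
  have hA : MeasurableSet {y : S | 0 < P {ω' | Y ω' = y}} := by
    simp_rw [hslice]
    exact measurableSet_lt measurable_const (measurable_measure_prodMk_left hdiag)
  have hE : MeasurableSet (D ∩ Prod.snd ⁻¹' ({y : S | 0 < P {ω' | Y ω' = y}})ᶜ) :=
    hdiag.inter (measurable_snd hA.compl)
  change P ((fun ω ↦ (X ω, Y ω)) ⁻¹'
    (D ∩ Prod.snd ⁻¹' ({y : S | 0 < P {ω' | Y ω' = y}})ᶜ)) = 0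
  have := Measure.isProbabilityMeasure_map (μ := P) hY.aemeasurable
  rw [← Measure.map_apply (hX.prodMk hY) hE,
    hindep.map_prod_eq_prod_map_map hX.aemeasurable hY.aemeasurable,
    Measure.measure_prod_null hE]
  refine Filter.Eventually.of_forall fun x ↦ ?_
  by_cases hx : 0 < P {ω | Y ω = x}
  · refine (congrArg (P.map Y) (Set.eq_empty_of_forall_notMem ?_)).trans measure_empty
    rintro y ⟨hxy : x = y, hy⟩
    subst hxy
    exact hy hx
  · refine measure_mono_null (fun y hy ↦ hy.1) ((hslice x).symm.trans ?_)
    exact nonpos_iff_eq_zero.mp (not_lt.mp hx)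
end
end
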